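/- arXiv:1409.8446 — 2 statements merged into one kernel-verified Lean document; each statement's English description precedes it below -/
import Mathlib

section
/- Let 0 < α < 1, a < b, and let f ∈ C¹[a,b]. Define the left Caputo fractional derivative D(t) = (1/Γ(1−α)) ∫ₐᵗ (t−u)^{−α} f′(u) du for t ∈ (a,b]. Then for every x ∈ (a,b], (1/Γ(α)) ∫ₐˣ (x−t)^{α−1} D(t) dt = f(x) − f(a). That is, applying the Riemann–Liouville fractional integral of order α to the Caputo fractional derivative of order α of f gives back f minus its zeroth Taylor term at a. -/
open Real intervalIntegral Set

section AbelKernel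

open MeasureTheory

/-- Euler's beta integral over an arbitrary interval. -/
theorem integral_sub_rpow_mul_sub_rpow {α β u x : ℝ} (hα : 0 < α) (hβ : 0 < β) (hux : u < x) :
    ∫ t in u..x, (x - t) ^ (α - 1) * (t - u) ^ (β - 1) =
      (x - u) ^ (α + β - 1) * ProbabilityTheory.beta α β := by
  have hpos : 0 < x - u := sub_pos.mpr hux
  have hshift : ∫ t in u..x, (x - t) ^ (α - 1) * (t - u) ^ (β - 1) =
      ∫ s in (0 : ℝ)..(x - u), s ^ (α - 1) * (x - u - s) ^ (β - 1) := by
    have h := intervalIntegral.integral_comp_sub_left (a := u) (b := x)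
      (fun s : ℝ => s ^ (α - 1) * (x - u - s) ^ (β - 1)) x
    rw [sub_self] at h
    rw [← h]
    congr 1
    ext t
    congr 2
    ring
  have hcomplex := Complex.betaIntegral_scaled (α : ℂ) (β : ℂ) hpos
  have hbeta : Complex.betaIntegral α β = (ProbabilityTheory.beta α β : ℂ) := by
    rw [Complex.betaIntegral_eq_Gamma_mul_div _ _ (by simpa) (by simpa), ProbabilityTheory.beta]
    simp only [← Complex.ofReal_add, Complex.Gamma_ofReal]
    norm_cast
  rw [hbeta] at hcomplex
  rw [hshift]
  apply Complex.ofReal_injective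
  rw [← intervalIntegral.integral_ofReal, Complex.ofReal_mul, Complex.ofReal_cpow hpos.le]
  push_cast at hcomplex ⊢
  rw [← hcomplex]
  refine intervalIntegral.integral_congr fun s hs => ?_
  rw [uIcc_of_le hpos.le] at hs
  have hs' : 0 ≤ x - u - s := sub_nonneg.mpr hs.2
  rw [Complex.ofReal_cpow hs.1, Complex.ofReal_cpow hs']
  push_cast
  rfl

/-- The Abel kernels of orders `α` and `1 - α` compose to a constant. -/
theorem integral_sub_rpow_mul_sub_rpow_neg {α u x : ℝ} (hα0 : 0 < α) (hα1 : α < 1)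
    (hux : u < x) :
    ∫ t in u..x, (x - t) ^ (α - 1) * (t - u) ^ (-α) = Real.Gamma α * Real.Gamma (1 - α) := by
  have h := integral_sub_rpow_mul_sub_rpow hα0 (sub_pos.mpr hα1) hux
  simpa [ProbabilityTheory.beta, show 1 - α - 1 = -α by ring] using h

/-- The kernel `(x - t) ^ (α - 1) * (t - u) ^ (-α)`, cut off to the region `u < t`. -/
noncomputable def abelKernel (α x u t : ℝ) : ℝ :=
  if u < t then (x - t) ^ (α - 1) * (t - u) ^ (-α) else 0

theorem measurable_abelKernel (α x : ℝ) :
    Measurable fun p : ℝ × ℝ => abelKernel α x p.1 p.2 := by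
  unfold abelKernel
  exact Measurable.ite (measurableSet_lt measurable_fst measurable_snd) (by fun_prop)
    measurable_const

theorem abelKernel_nonneg {α x u t : ℝ} (htx : t ≤ x) : 0 ≤ abelKernel α x u t := by
  unfold abelKernel
  split_ifs with h
  · exact mul_nonneg (rpow_nonneg (sub_nonneg.mpr htx) _) (rpow_nonneg (sub_nonneg.mpr h.le) _)
  · exact le_rfl

theorem setIntegral_abelKernel {α a u x : ℝ} (hα0 : 0 < α) (hα1 : α < 1) (hau : a ≤ u)
    (hux : u < x) :
    ∫ t in Ioc a x, abelKernel α x u t = Real.Gamma α * Real.Gamma (1 - α) := by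
  have hind : abelKernel α x u =
      (Ioi u).indicator fun t => (x - t) ^ (α - 1) * (t - u) ^ (-α) := by
    ext t
    simp [abelKernel, indicator_apply]
  rw [hind, setIntegral_indicator measurableSet_Ioi, Ioc_inter_Ioi, sup_eq_right.mpr hau,
    ← intervalIntegral.integral_of_le hux.le, integral_sub_rpow_mul_sub_rpow_neg hα0 hα1 hux]

theorem setIntegral_abelKernel_mul (α : ℝ) {a t x : ℝ} (hat : a ≤ t) (htx : t ≤ x)
    (g : ℝ → ℝ) :
    ∫ u in Ioc a x, abelKernel α x u t * g u =
      (x - t) ^ (α - 1) * ∫ u in a..t, (t - u) ^ (-α) * g u := by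
  have hind : (fun u => abelKernel α x u t * g u) =
      (Iio t).indicator fun u => (x - t) ^ (α - 1) * ((t - u) ^ (-α) * g u) := by
    ext u
    simp [abelKernel, indicator_apply, mul_assoc]
  have hset : Ioc a x ∩ Iio t = Ioo a t := by
    ext u
    simp only [mem_inter_iff, mem_Ioc, mem_Iio, mem_Ioo]
    exact ⟨fun h => ⟨h.1.1, h.2⟩, fun h => ⟨⟨h.1, h.2.le.trans htx⟩, h.2⟩⟩
  rw [hind, setIntegral_indicator measurableSet_Iio, hset, ← integral_Ioc_eq_integral_Ioo,
    ← intervalIntegral.integral_of_le hat, intervalIntegral.integral_const_mul]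

theorem integrable_abelKernel_mul {α a x : ℝ} (hα0 : 0 < α) (hα1 : α < 1) {g : ℝ → ℝ}
    (hg : IntegrableOn g (Ioc a x)) :
    Integrable (Function.uncurry fun u t => abelKernel α x u t * g u)
      ((volume.restrict (Ioc a x)).prod (volume.restrict (Ioc a x))) := by
  have hΓ : 0 < Real.Gamma α * Real.Gamma (1 - α) :=
    mul_pos (Real.Gamma_pos_of_pos hα0) (Real.Gamma_pos_of_pos (sub_pos.mpr hα1))
  have hmem : ∀ᵐ u ∂volume.restrict (Ioc a x), u ∈ Ioo a x := by
    rw [← restrict_Ioo_eq_restrict_Ioc]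
    exact ae_restrict_mem measurableSet_Ioo
  refine (integrable_prod_iff ((measurable_abelKernel α x).aestronglyMeasurable.mul
    hg.aestronglyMeasurable.comp_fst)).mpr ⟨?_, ?_⟩
  · filter_upwards [hmem] with u hu
    have hne : ∫ t in Ioc a x, abelKernel α x u t ≠ 0 := by
      rw [setIntegral_abelKernel hα0 hα1 hu.1.le hu.2]
      exact hΓ.ne'
    exact (Integrable.of_integral_ne_zero hne).mul_const (g u)
  · refine (hg.norm.const_mul (Real.Gamma α * Real.Gamma (1 - α))).congr ?_
    filter_upwards [hmem] with u hu
    rw [← setIntegral_abelKernel hα0 hα1 hu.1.le hu.2, ← MeasureTheory.integral_mul_const]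
    refine setIntegral_congr_fun measurableSet_Ioc fun t ht => ?_
    simp [abs_of_nonneg (abelKernel_nonneg (α := α) (u := u) ht.2)]

/-- Abel's composition formula: fractional integrals of orders `1 - α` and `α` compose to the
ordinary integral. -/
theorem integral_sub_rpow_mul_integral_sub_rpow_neg_mul {α a x : ℝ} (hα0 : 0 < α) (hα1 : α < 1)
    (hax : a ≤ x) {g : ℝ → ℝ} (hg : IntegrableOn g (Ioc a x)) :
    ∫ t in a..x, (x - t) ^ (α - 1) * ∫ u in a..t, (t - u) ^ (-α) * g u =
      Real.Gamma α * Real.Gamma (1 - α) * ∫ u in a..x, g u := by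
  calc ∫ t in a..x, (x - t) ^ (α - 1) * ∫ u in a..t, (t - u) ^ (-α) * g u
      = ∫ t in Ioc a x, ∫ u in Ioc a x, abelKernel α x u t * g u := by
        rw [intervalIntegral.integral_of_le hax]
        exact setIntegral_congr_fun measurableSet_Ioc fun t ht =>
          (setIntegral_abelKernel_mul α ht.1.le ht.2 g).symm
    _ = ∫ u in Ioc a x, ∫ t in Ioc a x, abelKernel α x u t * g u :=
        (integral_integral_swap (integrable_abelKernel_mul hα0 hα1 hg)).symm
    _ = ∫ u in Ioo a x, Real.Gamma α * Real.Gamma (1 - α) * g u := by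
        rw [integral_Ioc_eq_integral_Ioo]
        refine setIntegral_congr_fun measurableSet_Ioo fun u hu => ?_
        rw [MeasureTheory.integral_mul_const, setIntegral_abelKernel hα0 hα1 hu.1.le hu.2]
    _ = Real.Gamma α * Real.Gamma (1 - α) * ∫ u in a..x, g u := by
        rw [MeasureTheory.integral_const_mul, ← integral_Ioc_eq_integral_Ioo,
          ← intervalIntegral.integral_of_le hax]

end AbelKernel

/-- For `0 < α < 1`, `a < b` and `f ∈ C¹[a,b]`, with the left Caputo fractional
derivative `D t = (1/Γ (1 - α)) * ∫ u in a..t, (t - u) ^ (-α) * f' u`, one has, for every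
`x ∈ (a,b]`, `(1/Γ α) * ∫ t in a..x, (x - t) ^ (α - 1) * D t = f x - f a`. -/
theorem RL_integral_of_caputo_derivative
    (α a b : ℝ) (hα0 : 0 < α) (hα1 : α < 1) (hab : a < b)
    (f f' : ℝ → ℝ)
    (hf : ∀ t ∈ Set.Icc a b, HasDerivWithinAt f (f' t) (Set.Icc a b) t)
    (hf' : ContinuousOn f' (Set.Icc a b))
    (D : ℝ → ℝ)
    (hD : ∀ t ∈ Set.Ioc a b,
      D t = (1 / Real.Gamma (1 - α)) * ∫ u in a..t, (t - u) ^ (-α) * f' u) :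
    ∀ x ∈ Set.Ioc a b,
      (1 / Real.Gamma α) * (∫ t in a..x, (x - t) ^ (α - 1) * D t) = f x - f a := by
  rintro x ⟨hax, hxb⟩
  have hsub : Set.Icc a x ⊆ Set.Icc a b := Set.Icc_subset_Icc_right hxb
  have hcont : ContinuousOn f' (Set.Icc a x) := hf'.mono hsub
  have hD' : ∫ t in a..x, (x - t) ^ (α - 1) * D t =
      (1 / Real.Gamma (1 - α)) *
        ∫ t in a..x, (x - t) ^ (α - 1) * ∫ u in a..t, (t - u) ^ (-α) * f' u := by
    rw [← intervalIntegral.integral_const_mul, intervalIntegral.integral_of_le hax.le,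
      intervalIntegral.integral_of_le hax.le]
    refine MeasureTheory.setIntegral_congr_fun measurableSet_Ioc fun t ht => ?_
    rw [hD t ⟨ht.1, ht.2.trans hxb⟩]
    ring
  have hftc : ∫ u in a..x, f' u = f x - f a := by
    refine intervalIntegral.integral_eq_sub_of_hasDerivAt_of_le hax.le
      (fun t ht => (hf t (hsub ht)).continuousWithinAt.mono hsub) (fun t ht => ?_)
      (hcont.intervalIntegrable_of_Icc hax.le)
    exact (hf t ⟨ht.1.le, ht.2.le.trans hxb⟩).hasDerivAt
      (Icc_mem_nhds ht.1 (ht.2.trans_le hxb))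
  have hΓ : Real.Gamma α ≠ 0 := (Real.Gamma_pos_of_pos hα0).ne'
  have hΓ' : Real.Gamma (1 - α) ≠ 0 := (Real.Gamma_pos_of_pos (sub_pos.mpr hα1)).ne'
  rw [hD', integral_sub_rpow_mul_integral_sub_rpow_neg_mul hα0 hα1 hax.le
    (hcont.integrableOn_Icc.mono_set Set.Ioc_subset_Icc_self), hftc]
  field_simp
end

section
/- Let 0 < α < 1 and 0 < x < b. Let f ∈ C³[0,x] with f(0) = 0, and let g be the exact solution of the Abel integral equation f(y) = ∫₀^y g(t)/(y−t)^α dt, namely g(y) = (sin(απ)/π) ∫₀^y f′(t)/(y−t)^{1−α} dt. There exists a constant c′_α > 0, depending only on α, such that for every k ∈ ℕ, k ≥ 1, setting h = x/k and nodes t_j = j·h for j = 0,…,k, the approximate solution g̃(x) = (h^α/(Γ(1−α)·Γ(2+α))) · [ ((k−1)^{1+α} − (k−1−α)·k^α)·f′(0) + f′(x) + Σ_{j=1}^{k−1} ((k−j+1)^{1+α} − 2(k−j)^{1+α} + (k−j−1)^{1+α})·f′(t_j) ] satisfies |g(x) − g̃(x)| ≤ (1/Γ(1−α)) · c′_α ·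 ‖f‴‖_∞ · x^α · h², where ‖f‴‖_∞ = max_{t∈[0,x]} |f‴(t)|. -/
open Real intervalIntegral Set

theorem intervalIntegrable_sub_rpow {α x : ℝ} (hα : 0 < α) (a b : ℝ) :
    IntervalIntegrable (fun t => (x - t) ^ (α - 1)) MeasureTheory.volume a b := by
  have h : IntervalIntegrable (fun u : ℝ => u ^ (α - 1)) MeasureTheory.volume (x - a) (x - b) :=
    intervalIntegrable_rpow' (by linarith)
  simpa using h.comp_sub_left x

/-- Product integration of an affine function against the Abel kernel. -/
theorem integral_affine_mul_sub_rpow {α x a b : ℝ} (hα : 0 < α) (hab : a ≤ b) (hbx : b ≤ x)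
    (A m : ℝ) :
    ∫ t in a..b, (A + m * (t - a)) * (x - t) ^ (α - 1) =
      A * (x - a) ^ α / α - (A + m * (b - a)) * (x - b) ^ α / α +
        m * ((x - a) ^ (α + 1) - (x - b) ^ (α + 1)) / (α * (α + 1)) := by
  have hα' : α + 1 ≠ 0 := by positivity
  have key := integral_eq_sub_of_hasDerivAt_of_le
    (f := fun t => -((A + m * (t - a)) * (x - t) ^ α / α
      + m * (x - t) ^ (α + 1) / (α * (α + 1))))
    (f' := fun t => (A + m * (t - a)) * (x - t) ^ (α - 1)) hab ?_ ?_ ?_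
  · rw [key]
    field_simp
    ring
  · have h1 : Continuous fun t : ℝ => (x - t) ^ α :=
      (continuous_const.sub continuous_id).rpow_const fun _ => Or.inr hα.le
    have h2 : Continuous fun t : ℝ => (x - t) ^ (α + 1) :=
      (continuous_const.sub continuous_id).rpow_const fun _ => Or.inr (by positivity)
    exact Continuous.continuousOn (by fun_prop)
  · intro t ht
    have hxt : x - t ≠ 0 := by linarith [ht.2]
    have hs : HasDerivAt (fun t : ℝ => x - t) (-1) t := by
      simpa using (hasDerivAt_id t).const_sub x
    have h1 := hs.rpow_const (p := α) (Or.inl hxt)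
    have h2 := hs.rpow_const (p := α + 1) (Or.inl hxt)
    have hl : HasDerivAt (fun t : ℝ => A + m * (t - a)) m t := by
      simpa using (((hasDerivAt_id t).sub_const a).const_mul m).const_add A
    refine HasDerivAt.congr_deriv
      (((hl.mul h1).div_const α).add ((h2.const_mul m).div_const (α * (α + 1)))).neg ?_
    rw [add_sub_cancel_right]
    field_simp
    ring
  · exact (intervalIntegrable_sub_rpow hα a b).continuousOn_mul
      (Continuous.continuousOn (by fun_prop))

/-- Error of linear interpolation at the end points, when the derivative oscillates little. -/
theorem abs_sub_affine_interpolation_le {φ ψ : ℝ → ℝ} {a b M : ℝ} (hab : a < b)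
    (hφ : ContinuousOn φ (Icc a b)) (hφψ : ∀ t ∈ Ioo a b, HasDerivAt φ (ψ t) t)
    (hψ : ∀ s ∈ Ioo a b, ∀ t ∈ Ioo a b, |ψ s - ψ t| ≤ M) {t : ℝ} (ht : t ∈ Icc a b) :
    |φ t - (φ a + (φ b - φ a) / (b - a) * (t - a))| ≤ M * (b - a) := by
  obtain ⟨η, hη, hη'⟩ := exists_hasDerivAt_eq_slope φ ψ hab hφ hφψ
  have hM : 0 ≤ M := (abs_nonneg _).trans (hψ η hη η hη)
  rw [← hη']
  rcases ht.1.eq_or_lt with rfl | hat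
  · simpa using mul_nonneg hM (sub_nonneg.2 hab.le)
  · obtain ⟨ξ, hξ, hξ'⟩ := exists_hasDerivAt_eq_slope φ ψ hat
      (hφ.mono (Icc_subset_Icc_right ht.2)) fun s hs => hφψ s ⟨hs.1, hs.2.trans_le ht.2⟩
    have hpos : 0 < t - a := sub_pos.2 hat
    have : φ t - (φ a + ψ η * (t - a)) = (ψ ξ - ψ η) * (t - a) := by
      rw [hξ']; field_simp; ring
    rw [this, abs_mul, abs_of_pos hpos]
    exact mul_le_mul (hψ ξ ⟨hξ.1, hξ.2.trans_le ht.2⟩ η hη) (by linarith [ht.2]) hpos.le hM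

/-- Collecting the nodal values in a sum of contributions of consecutive nodes. -/
theorem sum_range_consecutive_eq (a b u : ℕ → ℝ) (n : ℕ) :
    ∑ j ∈ Finset.range (n + 1), (a j * u j + b (j + 1) * u (j + 1)) =
      a 0 * u 0 + b (n + 1) * u (n + 1) + ∑ j ∈ Finset.Icc 1 n, (a j + b j) * u j := by
  induction n with
  | zero => simp
  | succ n ih =>
    rw [Finset.sum_range_succ, ih, Finset.sum_Icc_succ_top (by omega)]
    ring

/-- The error of piecewise linear product integration on an equidistant grid. -/
theorem abs_integral_sub_sum_affine_le {α x M : ℝ} (hα : 0 < α) (hx : 0 < x) {φ ψ : ℝ → ℝ}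
    (hφ : ContinuousOn φ (Icc 0 x)) (hφψ : ∀ t ∈ Ioo 0 x, HasDerivAt φ (ψ t) t)
    (hψ : ∀ s ∈ Ioo 0 x, ∀ t ∈ Ioo 0 x, |ψ s - ψ t| ≤ M * |s - t|) (hM : 0 ≤ M)
    {k : ℕ} (hk : 1 ≤ k) {h : ℝ} (hh : h = x / k) :
    |(∫ t in (0 : ℝ)..x, φ t * (x - t) ^ (α - 1)) -
        ∑ j ∈ Finset.range k, ∫ t in (j * h)..((j + 1 : ℕ) * h),
          (φ (j * h) + (φ ((j + 1 : ℕ) * h) - φ (j * h)) / h * (t - j * h)) *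
            (x - t) ^ (α - 1)| ≤ M * h ^ 2 * (x ^ α / α) := by
  have hk0 : (0 : ℝ) < k := by exact_mod_cast hk
  have hh0 : 0 < h := hh ▸ div_pos hx hk0
  have hkh : k * h = x := by rw [hh]; field_simp
  have hw := intervalIntegrable_sub_rpow (x := x) hα
  have hnode : ∀ j < k, 0 ≤ j * h ∧ ((j + 1 : ℕ) : ℝ) * h ≤ x := fun j hj =>
    ⟨by positivity, by
      rw [← hkh]; exact mul_le_mul_of_nonneg_right (by exact_mod_cast hj) hh0.le⟩
  have hstep : ∀ j : ℕ, ((j + 1 : ℕ) : ℝ) * h - j * h = h := fun j => by push_cast; ring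
  have hlt : ∀ j : ℕ, (j : ℝ) * h < ((j + 1 : ℕ) : ℝ) * h := fun j => by linarith [hstep j]
  have hint : ∀ j < k, IntervalIntegrable (fun t => φ t * (x - t) ^ (α - 1))
      MeasureTheory.volume (j * h) ((j + 1 : ℕ) * h) := fun j hj =>
    (hw _ _).continuousOn_mul (hφ.mono (by
      rw [uIcc_of_le (hlt j).le]; exact Icc_subset_Icc (hnode j hj).1 (hnode j hj).2))
  have hsum := sum_integral_adjacent_intervals (a := fun j : ℕ => (j : ℝ) * h) hint
  have hsumw := sum_integral_adjacent_intervals (a := fun j : ℕ => (j : ℝ) * h)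
    (f := fun t => (x - t) ^ (α - 1)) (n := k) fun j _ => hw _ _
  have hwx : ∫ t in (0 : ℝ)..x, (x - t) ^ (α - 1) = x ^ α / α := by
    have := integral_affine_mul_sub_rpow hα hx.le le_rfl 1 0
    simpa [zero_rpow hα.ne'] using this
  simp only [Nat.cast_zero, zero_mul, hkh] at hsum hsumw
  rw [← hsum, ← hwx, ← hsumw, ← Finset.sum_sub_distrib, Finset.mul_sum]
  refine (Finset.abs_sum_le_sum_abs _ _).trans (Finset.sum_le_sum fun j hj => ?_)
  have hj := Finset.mem_range.1 hj
  obtain ⟨hj0, hjx⟩ := hnode j hj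
  rw [← integral_sub (hint j hj) ((hw _ _).continuousOn_mul
    (Continuous.continuousOn (by fun_prop))), ← integral_const_mul, ← Real.norm_eq_abs]
  refine norm_integral_le_of_norm_le (hlt j).le (.of_forall fun t ht => ?_)
    ((hw _ _).const_mul _)
  have hsub : ∀ s ∈ Ioo ((j : ℝ) * h) ((j + 1 : ℕ) * h), s ∈ Ioo 0 x := fun s hs =>
    ⟨hj0.trans_lt hs.1, hs.2.trans_le hjx⟩
  have key := abs_sub_affine_interpolation_le (M := M * h) (hlt j)
    (hφ.mono (Icc_subset_Icc hj0 hjx)) (fun s hs => hφψ s (hsub s hs))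
    (fun s hs r hr => (hψ s (hsub s hs) r (hsub r hr)).trans
      (mul_le_mul_of_nonneg_left
        (abs_sub_le_iff.2 ⟨by linarith [hs.2, hr.1, hstep j], by linarith [hs.1, hr.2, hstep j]⟩)
        hM)) (Ioc_subset_Icc_self ht)
  rw [hstep j] at key
  have hpos : 0 ≤ (x - t) ^ (α - 1) := rpow_nonneg (by linarith [ht.2]) _
  rw [← sub_mul, norm_mul, Real.norm_eq_abs, Real.norm_of_nonneg hpos, pow_two, ← mul_assoc]
  exact mul_le_mul_of_nonneg_right key hpos

/-- The modified trapezoidal rule integrates the piecewise linear interpolant exactly. -/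
theorem sum_integral_affine_eq {α x : ℝ} (hα : 0 < α) (hx : 0 < x) (u : ℕ → ℝ)
    {k : ℕ} (hk : 1 ≤ k) {h : ℝ} (hh : h = x / k) :
    ∑ j ∈ Finset.range k, ∫ t in (j * h)..((j + 1 : ℕ) * h),
        (u j + (u (j + 1) - u j) / h * (t - j * h)) * (x - t) ^ (α - 1) =
      h ^ α / (α * (α + 1)) *
        (((((k : ℝ) - 1) ^ (1 + α) - ((k : ℝ) - 1 - α) * (k : ℝ) ^ α) * u 0 + u k) +
          ∑ j ∈ Finset.Icc 1 (k - 1),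
            (((k : ℝ) - (j : ℝ) + 1) ^ (1 + α) - 2 * ((k : ℝ) - (j : ℝ)) ^ (1 + α) +
              ((k : ℝ) - (j : ℝ) - 1) ^ (1 + α)) * u j) := by
  have hk0 : (0 : ℝ) < k := by exact_mod_cast hk
  have hh0 : 0 < h := hh ▸ div_pos hx hk0
  have hkh : x = k * h := by rw [hh]; field_simp
  have hα' : α + 1 ≠ 0 := by positivity
  let a : ℕ → ℝ := fun j => (α + 1) * (k - j : ℝ) ^ α - (k - j : ℝ) ^ (1 + α) +
    (k - j - 1 : ℝ) ^ (1 + α)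
  let b : ℕ → ℝ := fun j => (k - j + 1 : ℝ) ^ (1 + α) - (k - j : ℝ) ^ (1 + α) -
    (α + 1) * (k - j : ℝ) ^ α
  have hterm : ∀ j ∈ Finset.range k, ∫ t in (j * h)..((j + 1 : ℕ) * h),
      (u j + (u (j + 1) - u j) / h * (t - j * h)) * (x - t) ^ (α - 1) =
        h ^ α / (α * (α + 1)) * (a j * u j + b (j + 1) * u (j + 1)) := by
    intro j hj
    have hj1 : (j : ℝ) + 1 ≤ k := by exact_mod_cast Finset.mem_range.1 hj
    rw [integral_affine_mul_sub_rpow hα (by push_cast; linarith)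
      (by rw [hkh]; push_cast; exact mul_le_mul_of_nonneg_right hj1 hh0.le)]
    have e1 : x - j * h = (k - j) * h := by rw [hkh]; ring
    have e2 : x - (j + 1 : ℕ) * h = (k - j - 1) * h := by rw [hkh]; push_cast; ring
    have e3 : ((j + 1 : ℕ) : ℝ) * h - j * h = h := by push_cast; ring
    have p1 : (0 : ℝ) ≤ k - j := by linarith
    have p2 : (0 : ℝ) ≤ k - j - 1 := by linarith
    have e4 : (k : ℝ) - (j + 1) + 1 = k - j := by ring
    have e5 : (k : ℝ) - (j + 1) = k - j - 1 := by ring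
    simp only [a, b]
    rw [e1, e2, e3, mul_rpow p1 hh0.le, mul_rpow p2 hh0.le, mul_rpow p1 hh0.le,
      mul_rpow p2 hh0.le, rpow_add_one hh0.ne', add_comm 1 α]
    push_cast
    rw [e4, e5]
    field_simp
    ring
  rw [Finset.sum_congr rfl hterm, ← Finset.mul_sum]
  obtain ⟨n, rfl⟩ := Nat.exists_eq_add_of_le' hk
  rw [sum_range_consecutive_eq, Nat.add_sub_cancel]
  have ha : a 0 = ((n + 1 : ℕ) - 1 : ℝ) ^ (1 + α) -
      ((n + 1 : ℕ) - 1 - α : ℝ) * ((n + 1 : ℕ) : ℝ) ^ α := by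
    simp only [a, Nat.cast_zero, sub_zero]
    rw [add_comm 1 α, rpow_add_one hk0.ne']
    ring
  have hb : b (n + 1) = 1 := by
    simp [b, zero_rpow hα.ne', zero_rpow (by positivity : 1 + α ≠ 0)]
  rw [ha, hb, one_mul]
  congr 2
  refine Finset.sum_congr rfl fun j _ => ?_
  simp only [a, b]
  ring

/-- Error bound for the approximate solution of the Abel integral equation.
Let `0 < α < 1`. There is a constant `c > 0`, depending only on `α`, such that for all
`0 < x < b`, every `f ∈ C³[0,x]` with `f 0 = 0`, and every `k ≥ 1` (step `h = x/k`, nodes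
`t_j = j*h`), the exact solution `g x = (sin (α π)/π) ∫ t in 0..x, f' t / (x - t)^(1-α)`
of the Abel equation and the approximation `g̃ x` given by the modified trapezoidal rule
satisfy `|g x - g̃ x| ≤ (1/Γ (1-α)) * c * ‖f‴‖_∞ * x^α * h²`. -/
theorem abel_approximate_solution_error
    (α : ℝ) (hα0 : 0 < α) (hα1 : α < 1) :
    ∃ c > 0, ∀ x b : ℝ, 0 < x → x < b → ∀ f : ℝ → ℝ,
      ContDiffOn ℝ 3 f (Set.Icc 0 x) → f 0 = 0 → ∀ k : ℕ, 1 ≤ k →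
      |Real.sin (α * π) / π *
            (∫ t in (0 : ℝ)..x, derivWithin f (Set.Icc 0 x) t / (x - t) ^ (1 - α)) -
          ((x / k) ^ α / (Real.Gamma (1 - α) * Real.Gamma (2 + α))) *
            (((((k : ℝ) - 1) ^ (1 + α) - ((k : ℝ) - 1 - α) * (k : ℝ) ^ α) *
                  derivWithin f (Set.Icc 0 x) 0 +
                derivWithin f (Set.Icc 0 x) x) +
              ∑ j ∈ Finset.Icc 1 (k - 1),
                (((k : ℝ) - (j : ℝ) + 1) ^ (1 + α) - 2 * ((k : ℝ) - (j : ℝ)) ^ (1 + α) +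
                    ((k : ℝ) - (j : ℝ) - 1) ^ (1 + α)) *
                  derivWithin f (Set.Icc 0 x) ((j : ℝ) * (x / k)))| ≤
        (1 / Real.Gamma (1 - α)) * c *
          sSup ((fun t => |iteratedDerivWithin 3 f (Set.Icc 0 x) t|) '' Set.Icc 0 x) *
          x ^ α * (x / k) ^ 2 := by
  have hΓ : 0 < Real.Gamma α := Real.Gamma_pos_of_pos hα0
  have hΓ' : 0 < Real.Gamma (1 - α) := Real.Gamma_pos_of_pos (by linarith)
  refine ⟨1 / (α * Real.Gamma α), by positivity, ?_⟩
  intro x b hx _ f hf _ k hk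
  set S := Icc (0 : ℝ) x with hS
  have hu : UniqueDiffOn ℝ S := uniqueDiffOn_Icc hx
  set φ := derivWithin f S with hφ
  set M := sSup ((fun t => |iteratedDerivWithin 3 f S t|) '' S) with hM
  have hφ1 : iteratedDerivWithin 1 f S = φ := by
    funext t; exact congrFun iteratedDerivWithin_one t
  have hφd : DifferentiableOn ℝ φ S := hφ1 ▸
    hf.differentiableOn_iteratedDerivWithin (m := 1) (by norm_num) hu
  have hψd : DifferentiableOn ℝ (iteratedDerivWithin 2 f S) S :=
    hf.differentiableOn_iteratedDerivWithin (m := 2) (by norm_num) hu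
  have hcont : ContinuousOn (fun t => |iteratedDerivWithin 3 f S t|) S :=
    (hf.continuousOn_iteratedDerivWithin (m := 3) le_rfl hu).abs
  have hbound : ∀ t ∈ S, |iteratedDerivWithin 3 f S t| ≤ M := fun t ht =>
    le_csSup (isCompact_Icc.image_of_continuousOn hcont).bddAbove (mem_image_of_mem _ ht)
  have hM0 : 0 ≤ M := (abs_nonneg _).trans (hbound 0 (left_mem_Icc.2 hx.le))
  have hφψ : ∀ t ∈ Ioo 0 x, HasDerivAt φ (iteratedDerivWithin 2 f S t) t := by
    intro t ht
    have := (hφd t (Ioo_subset_Icc_self ht)).hasDerivWithinAt.hasDerivAt (Icc_mem_nhds ht.1 ht.2)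
    rwa [← hφ1, ← iteratedDerivWithin_succ, hφ1] at this
  have hlip : ∀ s ∈ Ioo 0 x, ∀ t ∈ Ioo 0 x,
      |iteratedDerivWithin 2 f S s - iteratedDerivWithin 2 f S t| ≤ M * |s - t| :=
    fun s hs t ht => (convex_Icc 0 x).norm_image_sub_le_of_norm_derivWithin_le hψd
      (fun r hr => by
        rw [← iteratedDerivWithin_succ]
        exact hbound r hr) (Ioo_subset_Icc_self ht) (Ioo_subset_Icc_self hs)
  have herr := abs_integral_sub_sum_affine_le hα0 hx hφd.continuousOn hφψ hlip hM0 hk rfl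
  have hsum := sum_integral_affine_eq hα0 hx (fun j => φ (j * (x / k))) hk rfl
  have hk0 : (k : ℝ) ≠ 0 := by positivity
  simp only [Nat.cast_zero, zero_mul, mul_div_cancel₀ x hk0] at hsum
  rw [hsum] at herr
  have hker : ∫ t in (0 : ℝ)..x, φ t / (x - t) ^ (1 - α) =
      ∫ t in (0 : ℝ)..x, φ t * (x - t) ^ (α - 1) := by
    refine integral_congr fun t ht => ?_
    rw [uIcc_of_le hx.le] at ht
    rw [← neg_sub 1 α, rpow_neg (sub_nonneg.2 ht.2), div_eq_mul_inv]
  have hsin : Real.sin (α * π) / π = 1 / (Real.Gamma α * Real.Gamma (1 - α)) := by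
    rw [Real.Gamma_mul_Gamma_one_sub, one_div_div, mul_comm]
  have hΓ2 : Real.Gamma (2 + α) = (α + 1) * (α * Real.Gamma α) := by
    rw [show 2 + α = α + 1 + 1 by ring, Real.Gamma_add_one (by positivity),
      Real.Gamma_add_one hα0.ne']
  rw [hker, hsin, hΓ2]
  generalize ∫ t in (0 : ℝ)..x, φ t * (x - t) ^ (α - 1) = I at herr ⊢
  have hC : 0 ≤ 1 / (Real.Gamma α * Real.Gamma (1 - α)) := by positivity
  have hfin := mul_le_mul_of_nonneg_left herr hC
  rw [← abs_of_nonneg hC, ← abs_mul, abs_of_nonneg hC] at hfin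
  refine (le_of_eq ?_).trans (hfin.trans (le_of_eq ?_))
  · congr 1
    rw [mul_sub, ← mul_assoc _ ((x / (k : ℝ)) ^ α / (α * (α + 1)))]
    congr 2
    field_simp
  · field_simp
end
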